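/- arXiv:1804.05966 — 5 statements merged into one kernel-verified Lean document; each statement's English description precedes it below -/
import Mathlib

section
/- Let G be a finite simple graph with adjacency matrix A_G for which there exists a PPSC sequence h (i.e. h : ℕ → ℝ with h_k > 0 for all k and ∑_{k=0}^∞ h_k A_G^k convergent) such that ∑_{k=0}^∞ h_k A_G^k is constant diagonal, and let H be a finite walk-regular simple graph containing at least one triangle, with adjacency matrix A_H. Then there exists a PPSC sequence c (c : ℕ → ℝ with c_k > 0 for all k) such that the series ∑_{k=0}^∞ c_k (A_G ⊗ A_H)^k converges and its sum is constant diagonal, where ⊗ denotes the Kronecker product. -/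
open Matrix Kronecker
open scoped Classical

/-- The real adjacency matrix of a simple graph. -/
noncomputable def adjMat {V : Type*} (G : SimpleGraph V) : Matrix V V ℝ :=
  Matrix.of fun i j => if G.Adj i j then (1 : ℝ) else 0

/-- A square matrix is constant diagonal if all diagonal entries agree. -/
def ConstDiag {n : Type*} (M : Matrix n n ℝ) : Prop := ∀ i j : n, M i i = M j j

/-- A finite simple graph is walk-regular if every power of its adjacency matrix is
constant diagonal. -/
def WalkRegular {V : Type*} [Fintype V] [DecidableEq V] (G : SimpleGraph V) : Prop :=
  ∀ ℓ : ℕ, ConstDiag (adjMat G ^ ℓ)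

theorem Matrix.hasSum_iff_apply {ι m n : Type*} {f : ι → Matrix m n ℝ} {M : Matrix m n ℝ} :
    HasSum f M ↔ ∀ i j, HasSum (fun k => f k i j) (M i j) :=
  (Pi.hasSum (f := f) (g := M)).trans (forall_congr' fun _ => Pi.hasSum)

theorem Matrix.summable_iff_apply {ι m n : Type*} {f : ι → Matrix m n ℝ} :
    Summable f ↔ ∀ i j, Summable fun k => f k i j :=
  (Pi.summable (f := f)).trans (forall_congr' fun _ => Pi.summable)

theorem Matrix.tsum_apply_apply {ι m n : Type*} {f : ι → Matrix m n ℝ} (hf : Summable f)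
    (i : m) (j : n) : (∑' k, f k) i j = ∑' k, f k i j :=
  ((Matrix.hasSum_iff_apply.1 hf.hasSum) i j).tsum_eq.symm

theorem Matrix.kronecker_pow_real {m n : Type*} [Fintype m] [DecidableEq m] [Fintype n]
    [DecidableEq n] (A : Matrix m m ℝ) (B : Matrix n n ℝ) (k : ℕ) :
    (A ⊗ₖ B) ^ k = (A ^ k) ⊗ₖ (B ^ k) := by
  induction k with
  | zero => simp
  | succ k ih => rw [pow_succ, ih, pow_succ, pow_succ, Matrix.mul_kronecker_mul]

section AdjMat

variable {V : Type*} (G : SimpleGraph V)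

theorem adjMat_nonneg (i j : V) : 0 ≤ adjMat G i j := by
  simp only [adjMat, Matrix.of_apply]; split_ifs <;> norm_num

theorem adjMat_le_one (i j : V) : adjMat G i j ≤ 1 := by
  simp only [adjMat, Matrix.of_apply]; split_ifs <;> norm_num

theorem adjMat_apply_self (i : V) : adjMat G i i = 0 := by
  simp [adjMat]

variable {G} in
theorem adjMat_of_adj {i j : V} (h : G.Adj i j) : adjMat G i j = 1 := by
  simp [adjMat, h]

theorem adjMat_isSymm : (adjMat G).IsSymm := by
  ext i j; simp [adjMat, G.adj_comm]

variable [Fintype V] [DecidableEq V]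

theorem adjMat_pow_nonneg (k : ℕ) (i j : V) : 0 ≤ (adjMat G ^ k) i j := by
  induction k generalizing i j with
  | zero => rw [pow_zero, Matrix.one_apply]; split_ifs <;> norm_num
  | succ k ih =>
    rw [pow_succ, Matrix.mul_apply]
    exact Finset.sum_nonneg fun l _ => mul_nonneg (ih i l) (adjMat_nonneg G l j)

theorem adjMat_pow_mul_le (p q : ℕ) (i j l : V) :
    (adjMat G ^ p) i l * (adjMat G ^ q) l j ≤ (adjMat G ^ (p + q)) i j := by
  rw [pow_add, Matrix.mul_apply]
  exact Finset.single_le_sum (f := fun l => (adjMat G ^ p) i l * (adjMat G ^ q) l j)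
    (fun x _ => mul_nonneg (adjMat_pow_nonneg G p i x) (adjMat_pow_nonneg G q x j))
    (Finset.mem_univ l)

theorem adjMat_pow_succ_le {k : ℕ} {i : V} {C : ℝ} (hC : ∀ l, (adjMat G ^ k) i l ≤ C) (j : V) :
    (adjMat G ^ (k + 1)) i j ≤ Fintype.card V * C := by
  rw [pow_succ, Matrix.mul_apply]
  calc ∑ l, (adjMat G ^ k) i l * adjMat G l j ≤ ∑ _l : V, C :=
        Finset.sum_le_sum fun l _ =>
          (mul_le_of_le_one_right (adjMat_pow_nonneg G k i l) (adjMat_le_one G l j)).trans (hC l)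
    _ = Fintype.card V * C := by simp

variable {G}

theorem WalkRegular.pow_two_mul_le (hG : WalkRegular G) (m : ℕ) (v i j : V) :
    (adjMat G ^ (2 * m)) i j ≤ (adjMat G ^ (2 * m)) v v := by
  have hsymm : ∀ x y, (adjMat G ^ m) x y = (adjMat G ^ m) y x := fun x y =>
    ((adjMat_isSymm G).pow m).apply y x
  have hmul : ∀ x y, (adjMat G ^ (2 * m)) x y
      = ∑ l, (adjMat G ^ m) x l * (adjMat G ^ m) y l := fun x y => by
    rw [two_mul, pow_add, Matrix.mul_apply]
    exact Finset.sum_congr rfl fun l _ => by rw [hsymm l y]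
  have hi := hG (2 * m) i v
  have hj := hG (2 * m) j v
  have key : 2 * (adjMat G ^ (2 * m)) i j
      ≤ (adjMat G ^ (2 * m)) i i + (adjMat G ^ (2 * m)) j j := by
    rw [hmul, hmul, hmul, Finset.mul_sum, ← Finset.sum_add_distrib]
    exact Finset.sum_le_sum fun l _ => by
      nlinarith [sq_nonneg ((adjMat G ^ m) i l - (adjMat G ^ m) j l)]
  linarith

theorem adjMat_pow_apply_self_pos_of_triangle {a b c : V} (hab : G.Adj a b) (hbc : G.Adj b c)
    (hac : G.Adj a c) (k : ℕ) (hk : k ≠ 1) : 0 < (adjMat G ^ k) a a := by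
  have h2 : 1 ≤ (adjMat G ^ 2) a a := by
    simpa [adjMat_of_adj hab, adjMat_of_adj hab.symm] using adjMat_pow_mul_le G 1 1 a a b
  have hac2 : 1 ≤ (adjMat G ^ 2) a c := by
    simpa [adjMat_of_adj hab, adjMat_of_adj hbc] using adjMat_pow_mul_le G 1 1 a c b
  have h3 : 1 ≤ (adjMat G ^ 3) a a := by
    have := adjMat_pow_mul_le G 2 1 a a c
    rw [pow_one, adjMat_of_adj hac.symm, mul_one] at this
    exact hac2.trans this
  induction k using Nat.strong_induction_on with
  | _ k ih =>
    match k, hk with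
    | 0, _ => simp
    | 2, _ => linarith
    | 3, _ => linarith
    | k + 4, _ =>
      exact (mul_pos (ih (k + 2) (by omega) (by omega)) (by linarith)).trans_le
        (adjMat_pow_mul_le G (k + 2) 2 a a a)

/-- In a walk-regular graph with a triangle, the entries of each power of the adjacency matrix are
dominated by its diagonal, up to a constant independent of the power. -/
theorem WalkRegular.exists_pow_apply_le (hG : WalkRegular G) {v : V}
    (hpos : 0 < (adjMat G ^ 3) v v) :
    ∃ K : ℝ, ∀ k, k ≠ 1 → ∀ i j, (adjMat G ^ k) i j ≤ K * (adjMat G ^ k) v v := by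
  set N := (Fintype.card V : ℝ)
  have hN : 0 ≤ N := Nat.cast_nonneg _
  refine ⟨1 + N ^ 3 / (adjMat G ^ 3) v v, fun k hk i j => ?_⟩
  have hC : 0 ≤ N ^ 3 / (adjMat G ^ 3) v v := by positivity
  have hvv := adjMat_pow_nonneg G k v v
  rw [add_mul, one_mul]
  obtain ⟨m, rfl | rfl⟩ := Nat.even_or_odd' k
  · exact (hG.pow_two_mul_le m v i j).trans (le_add_of_nonneg_right (mul_nonneg hC hvv))
  · obtain ⟨m, rfl⟩ : ∃ n, m = n + 1 := ⟨m - 1, by omega⟩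
    have h1 : (adjMat G ^ (2 * (m + 1) + 1)) i j ≤ N * (adjMat G ^ (2 * (m + 1))) v v :=
      adjMat_pow_succ_le G (hG.pow_two_mul_le (m + 1) v i) j
    have h2 : (adjMat G ^ (2 * (m + 1))) v v ≤ N * (N * (adjMat G ^ (2 * m)) v v) :=
      adjMat_pow_succ_le G (adjMat_pow_succ_le G (hG.pow_two_mul_le m v v)) v
    have h3 : (adjMat G ^ (2 * m)) v v * (adjMat G ^ 3) v v
        ≤ (adjMat G ^ (2 * (m + 1) + 1)) v v := adjMat_pow_mul_le G (2 * m) 3 v v v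
    refine le_add_of_nonneg_of_le hvv ?_
    calc (adjMat G ^ (2 * (m + 1) + 1)) i j
        ≤ N * (N * (N * (adjMat G ^ (2 * m)) v v)) :=
          h1.trans (mul_le_mul_of_nonneg_left h2 hN)
      _ = N ^ 3 / (adjMat G ^ 3) v v * ((adjMat G ^ (2 * m)) v v * (adjMat G ^ 3) v v) := by
          field_simp
      _ ≤ _ := mul_le_mul_of_nonneg_left h3 hC

end AdjMat

/-- If `G` admits a PPSC sequence `h` whose matrix power series at `A_G`
converges to a constant-diagonal matrix, and `H` is walk-regular and contains a triangle,
then there is a PPSC sequence `c` whose power series at `A_G ⊗ A_H` converges and has a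
constant-diagonal sum. -/
theorem tensor_ppsc_constDiag {α β : Type*} [Fintype α] [DecidableEq α]
    [Fintype β] [DecidableEq β] (G : SimpleGraph α) (H : SimpleGraph β)
    (h : ℕ → ℝ) (hpos : ∀ k, 0 < h k)
    (hsum : Summable fun k : ℕ => h k • adjMat G ^ k)
    (hcd : ConstDiag (∑' k : ℕ, h k • adjMat G ^ k))
    (hwr : WalkRegular H)
    (htri : ∃ a b c : β, H.Adj a b ∧ H.Adj b c ∧ H.Adj a c) :
    ∃ c : ℕ → ℝ, (∀ k, 0 < c k) ∧
      (Summable fun k : ℕ => c k • (adjMat G ⊗ₖ adjMat H) ^ k) ∧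
      ConstDiag (∑' k : ℕ, c k • (adjMat G ⊗ₖ adjMat H) ^ k) := by
  obtain ⟨v, b, w, hvb, hbw, hvw⟩ := htri
  have hdiag := adjMat_pow_apply_self_pos_of_triangle hvb hbw hvw
  obtain ⟨K, hK⟩ := hwr.exists_pow_apply_le (hdiag 3 (by norm_num))
  set c : ℕ → ℝ := fun k => if k = 1 then 1 else h k / (adjMat H ^ k) v v with hc
  have hc_of_ne : ∀ k, k ≠ 1 → c k = h k / (adjMat H ^ k) v v := fun k hk => by simp [hc, hk]
  have hcpos : ∀ k, 0 < c k := fun k => by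
    by_cases hk : k = 1
    · simp [hc, hk]
    · rw [hc_of_ne k hk]
      exact div_pos (hpos k) (hdiag k hk)
  have happly : ∀ k i j i' j', (c k • (adjMat G ⊗ₖ adjMat H) ^ k) (i, i') (j, j')
      = c k * ((adjMat G ^ k) i j * (adjMat H ^ k) i' j') := fun k i j i' j' => by
    rw [Matrix.kronecker_pow_real, Matrix.smul_apply, Matrix.kronecker_apply, smul_eq_mul]
  have hS : Summable fun k : ℕ => c k • (adjMat G ⊗ₖ adjMat H) ^ k := by
    refine Matrix.summable_iff_apply.2 ?_
    rintro ⟨i, i'⟩ ⟨j, j'⟩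
    have hG := (Matrix.summable_iff_apply.1 hsum i j).mul_left K
    refine hG.of_norm_bounded_eventually ?_
    rw [Nat.cofinite_eq_atTop]
    filter_upwards [Filter.eventually_ge_atTop 2] with k hk
    have hk1 : k ≠ 1 := by omega
    have hA := adjMat_pow_nonneg G k i j
    rw [happly, Real.norm_of_nonneg (mul_nonneg (hcpos k).le
      (mul_nonneg hA (adjMat_pow_nonneg H k i' j')))]
    calc c k * ((adjMat G ^ k) i j * (adjMat H ^ k) i' j')
        ≤ c k * ((adjMat G ^ k) i j * (K * (adjMat H ^ k) v v)) := by
          have := hK k hk1 i' j'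
          have := (hcpos k).le
          gcongr
      _ = K * (h k • adjMat G ^ k) i j := by
          rw [hc_of_ne k hk1, Matrix.smul_apply, smul_eq_mul]
          have := (hdiag k hk1).ne'
          field_simp
  refine ⟨c, hcpos, hS, ?_⟩
  have hterm : ∀ i i', (∑' k : ℕ, c k • (adjMat G ⊗ₖ adjMat H) ^ k) (i, i') (i, i')
      = (∑' k : ℕ, h k • adjMat G ^ k) i i := fun i i' => by
    rw [Matrix.tsum_apply_apply hS, Matrix.tsum_apply_apply hsum]
    refine tsum_congr fun k => ?_
    rw [happly, Matrix.smul_apply, smul_eq_mul]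
    by_cases hk : k = 1
    · subst hk
      simp [adjMat_apply_self]
    · rw [hc_of_ne k hk, hwr k i' v]
      have := (hdiag k hk).ne'
      field_simp
  rintro ⟨i, i'⟩ ⟨j, j'⟩
  rw [hterm, hterm]
  exact hcd i j
end

section
/- Let G be a finite simple graph on n vertices with adjacency matrix A and walk matrix W, and let J be a set of vertices of G. If there exists an entrywise strictly positive vector x such that for every j ∈ J the j-th entry of W·x equals 1, then there exist a PPSC sequence c (c : ℕ → ℝ with c_k > 0 for all k, with ∑_{k=0}^∞ c_k A^k convergent) and a real constant t such that (∑_{k=0}^∞ c_k A^k)_{jj} = t for every j ∈ J. -/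
open Matrix Kronecker
open scoped Classical

/-- The walk matrix of a graph on \`n\` vertices: the \`ℓ\`-th column (\`ℓ = 0, …, n-3\`) is the
diagonal of \`A^(ℓ+2)\`. -/
noncomputable def walkMatrix {V : Type*} [Fintype V] [DecidableEq V] (G : SimpleGraph V) :
    Matrix V (Fin (Fintype.card V - 2)) ℝ :=
  Matrix.of fun v ℓ => (adjMat G ^ ((ℓ : ℕ) + 2)) v v

/-- Finitely many real sequences admit a common strictly positive weight that makes all of them
summable. -/
theorem exists_pos_forall_summable_mul {ι : Type*} [Fintype ι] (f : ι → ℕ → ℝ) :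
    ∃ d : ℕ → ℝ, (∀ k, 0 < d k) ∧ ∀ i, Summable fun k => d k * f i k := by
  have hpos : ∀ k, 0 < 1 + ∑ i, |f i k| := fun k => by positivity
  refine ⟨fun k => (1 / 2) ^ k / (1 + ∑ i, |f i k|), fun k => div_pos (by positivity) (hpos k),
    fun i => Summable.of_norm_bounded summable_geometric_two fun k => ?_⟩
  have hle : |f i k| ≤ ∑ i, |f i k| :=
    Finset.single_le_sum (f := fun i => |f i k|) (fun _ _ => abs_nonneg _) (Finset.mem_univ i)
  have hdiv : 0 < (1 / 2 : ℝ) ^ k / (1 + ∑ i, |f i k|) := div_pos (by positivity) (hpos k)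
  rw [Real.norm_eq_abs, abs_mul, abs_of_pos hdiv, div_mul_eq_mul_div, div_le_iff₀ (hpos k)]
  gcongr
  linarith

/-- By Cayley-Hamilton, the diagonal of every power of the adjacency matrix is a combination of the
all-ones vector and the columns of the walk matrix. -/
theorem exists_diag_pow_adjMat_eq {V : Type*} [Fintype V] [DecidableEq V] (G : SimpleGraph V)
    (k : ℕ) : ∃ (b : ℝ) (a : Fin (Fintype.card V - 2) → ℝ), ∀ j,
      (adjMat G ^ k) j j = b + ∑ ℓ, a ℓ * walkMatrix G j ℓ := by
  set p : Polynomial ℝ := Polynomial.X ^ k %ₘ (adjMat G).charpoly with hp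
  have hdeg : p.natDegree < Fintype.card V - 2 + 2 := by
    rcases Nat.lt_or_ge (Fintype.card V) 2 with h2 | h2
    · have h := Polynomial.natDegree_modByMonic_le (Polynomial.X ^ k : Polynomial ℝ)
        (adjMat G).charpoly_monic
      rw [Matrix.charpoly_natDegree_eq_dim, ← hp] at h
      omega
    · have h := Polynomial.natDegree_modByMonic_lt (Polynomial.X ^ k : Polynomial ℝ)
        (adjMat G).charpoly_monic (fun h1 => by
          have hdim := (adjMat G).charpoly_natDegree_eq_dim
          rw [h1, Polynomial.natDegree_one] at hdim
          omega)
      rw [Matrix.charpoly_natDegree_eq_dim, ← hp] at h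
      omega
  refine ⟨p.coeff 0, fun ℓ => p.coeff (ℓ + 2), fun j => ?_⟩
  have hdiag : adjMat G j j = 0 := by simp [adjMat]
  rw [Matrix.pow_eq_aeval_mod_charpoly, ← hp, Polynomial.aeval_eq_sum_range' hdeg,
    Finset.sum_range_succ', Finset.sum_range_succ', ← Fin.sum_univ_eq_sum_range
      (fun i => p.coeff (i + 1 + 1) • adjMat G ^ (i + 1 + 1))]
  simp [Matrix.sum_apply, hdiag, walkMatrix, add_comm (p.coeff 0)]

/-- Placing finitely many weights `y i` at the positions `e i` turns a series against `g` into a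
finite sum. -/
theorem hasSum_sum_ite_mul {ι : Type*} [Fintype ι] (e : ι → ℕ) (y : ι → ℝ) (g : ℕ → ℝ) :
    HasSum (fun k => (∑ i, if k = e i then y i else 0) * g k) (∑ i, y i * g (e i)) := by
  simp_rw [Finset.sum_mul]
  refine hasSum_sum fun i _ => ?_
  convert hasSum_ite_eq (e i) (y i * g (e i)) using 2 with k
  split_ifs with h <;> simp [h]

/-- If the rows of the walk matrix indexed by `J` admit an entrywise
positive vector `x` with `(W·x)_j = 1` for all `j ∈ J`, then some PPSC power series of the
adjacency matrix has equal diagonal entries at all vertices of `J` (a collision). -/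
theorem ppsc_collision_of_pos_solution {V : Type*} [Fintype V] [DecidableEq V]
    (G : SimpleGraph V) (J : Set V)
    (x : Fin (Fintype.card V - 2) → ℝ) (hx : ∀ i, 0 < x i)
    (hWx : ∀ j ∈ J, (walkMatrix G).mulVec x j = 1) :
    ∃ c : ℕ → ℝ, (∀ k, 0 < c k) ∧
      (Summable fun k : ℕ => c k • adjMat G ^ k) ∧
      ∃ t : ℝ, ∀ j ∈ J, (∑' k : ℕ, c k • adjMat G ^ k) j j = t := by
  choose b a hab using exists_diag_pow_adjMat_eq G
  obtain ⟨d, hd, hsum⟩ := exists_pos_forall_summable_mul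
    (ι := (V × V) ⊕ Option (Fin (Fintype.card V - 2)))
    (Sum.elim (fun p k => (adjMat G ^ k) p.1 p.2) (fun o k => o.elim (b k) (a k)))
  have hA : ∀ i j, Summable fun k => d k * (adjMat G ^ k) i j := fun i j => hsum (.inl (i, j))
  have hb : Summable fun k => d k * b k := hsum (.inr none)
  have ha : ∀ ℓ, Summable fun k => d k * a k ℓ := fun ℓ => hsum (.inr (some ℓ))
  obtain ⟨ε, hε, hεx⟩ : ∃ ε : ℝ, 0 < ε ∧ ∀ ℓ, ε * ∑' k, d k * a k ℓ < x ℓ := by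
    have h : ∀ᶠ ε : ℝ in nhdsWithin 0 (Set.Ioi 0), ∀ ℓ, ε * ∑' k, d k * a k ℓ < x ℓ := by
      refine Filter.eventually_all.2 fun ℓ => Filter.Eventually.filter_mono nhdsWithin_le_nhds ?_
      have hc : Continuous fun ε : ℝ => ε * ∑' k, d k * a k ℓ := by fun_prop
      exact hc.continuousAt.eventually_lt continuousAt_const (by simpa using hx ℓ)
    exact ((eventually_mem_nhdsWithin (a := (0 : ℝ)) (s := Set.Ioi 0)).and h).exists
  set y : Fin (Fintype.card V - 2) → ℝ := fun ℓ => x ℓ - ε * ∑' k, d k * a k ℓ with hy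
  have hypos : ∀ ℓ, 0 < y ℓ := fun ℓ => sub_pos.2 (hεx ℓ)
  have hentry : ∀ i j, HasSum
      (fun k => (ε * d k + ∑ ℓ : Fin (Fintype.card V - 2), if k = (ℓ : ℕ) + 2 then y ℓ else 0) *
        (adjMat G ^ k) i j)
      (ε * (∑' k, d k * (adjMat G ^ k) i j) +
        ∑ ℓ : Fin (Fintype.card V - 2), y ℓ * (adjMat G ^ ((ℓ : ℕ) + 2)) i j) := by
    intro i j
    simp_rw [add_mul, mul_assoc]
    exact ((hA i j).hasSum.mul_left ε).add
      (hasSum_sum_ite_mul (fun ℓ : Fin (Fintype.card V - 2) => (ℓ : ℕ) + 2) y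
        fun k => (adjMat G ^ k) i j)
  have hmat : HasSum
      (fun k => (ε * d k + ∑ ℓ : Fin (Fintype.card V - 2), if k = (ℓ : ℕ) + 2 then y ℓ else 0) •
        adjMat G ^ k)
      (Matrix.of fun i j => ε * (∑' k, d k * (adjMat G ^ k) i j) +
        ∑ ℓ : Fin (Fintype.card V - 2), y ℓ * (adjMat G ^ ((ℓ : ℕ) + 2)) i j) :=
    Pi.hasSum.2 fun i => Pi.hasSum.2 fun j => hentry i j
  refine ⟨_, fun k => ?_, hmat.summable, ε * (∑' k, d k * b k) + 1, fun j hj => ?_⟩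
  · refine add_pos_of_pos_of_nonneg (mul_pos hε (hd k)) (Finset.sum_nonneg fun ℓ _ => ?_)
    split_ifs
    exacts [(hypos ℓ).le, le_rfl]
  · have hdiag : HasSum (fun k => d k * (adjMat G ^ k) j j)
        ((∑' k, d k * b k) + ∑ ℓ, (∑' k, d k * a k ℓ) * walkMatrix G j ℓ) := by
      simp_rw [hab, mul_add, Finset.mul_sum, ← mul_assoc]
      exact hb.hasSum.add (hasSum_sum fun ℓ _ => (ha ℓ).hasSum.mul_right _)
    have hW : ∑ ℓ, walkMatrix G j ℓ * x ℓ = 1 := hWx j hj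
    have hyW : ∑ ℓ, y ℓ * walkMatrix G j ℓ =
        1 - ε * ∑ ℓ, (∑' k, d k * a k ℓ) * walkMatrix G j ℓ := by
      rw [← hW, Finset.mul_sum, ← Finset.sum_sub_distrib]
      exact Finset.sum_congr rfl fun ℓ _ => by rw [hy]; ring
    change ∑ ℓ : Fin (Fintype.card V - 2), y ℓ * (adjMat G ^ ((ℓ : ℕ) + 2)) j j = _ at hyW
    rw [hmat.tsum_eq, Matrix.of_apply, hdiag.tsum_eq, hyW]
    ring
end

section
/- Let M be a real matrix with all entries nonnegative (rows and columns indexed by finite types) and let e be the all-ones vector. If there exists an entrywise nonnegative vector x with M·x = e, then M satisfies the set-average flip-flop property: for every pair of disjoint nonempty subsets S and T of the row indices, there exists a column index j such that the average of the entries M_{t,j} over t ∈ T is less than or equal to the average of the entries M_{s,j} over s ∈ S. -/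
open Matrix

/-- If `M·x = e`, then averaging the rows of `M` over a nonempty set and pairing with `x`
gives `1`. -/
theorem sum_average_mul_eq_one {ι κ : Type*} [Fintype κ] {M : Matrix ι κ ℝ} {x : κ → ℝ}
    (hMx : M.mulVec x = fun _ => 1) {A : Finset ι} (hA : A.Nonempty) :
    ∑ j, (∑ a ∈ A, M a j) / (A.card : ℝ) * x j = 1 := by
  have hcard : (A.card : ℝ) ≠ 0 := by exact_mod_cast hA.card_pos.ne'
  have hrow (a : ι) : ∑ j, M a j * x j = 1 := congrFun hMx a
  simp_rw [div_mul_eq_mul_div, ← Finset.sum_div, Finset.sum_mul]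
  rw [Finset.sum_comm]
  simp [hrow, hcard]

/-- If a nonnegative matrix `M` satisfies `M·x = e` for some entrywise
nonnegative vector `x` (with `e` the all-ones vector), then `M` has the set-average
flip-flop property: for every pair of disjoint nonempty finite sets `S, T` of row indices
there is a column `j` with `avg(M(T,j)) ≤ avg(M(S,j))`. -/
theorem saff_of_nonneg_solution {ι κ : Type*} [Fintype ι] [Fintype κ]
    (M : Matrix ι κ ℝ) (hM : ∀ i j, 0 ≤ M i j)
    (x : κ → ℝ) (hx : ∀ j, 0 ≤ x j) (hMx : M.mulVec x = fun _ => 1) :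
    ∀ S T : Finset ι, S.Nonempty → T.Nonempty → Disjoint S T →
      ∃ j : κ, (∑ t ∈ T, M t j) / (T.card : ℝ) ≤ (∑ s ∈ S, M s j) / (S.card : ℝ) := by
  intro S T hS hT _
  by_contra! h
  have hSx := sum_average_mul_eq_one hMx hS
  have hTx := sum_average_mul_eq_one hMx hT
  obtain ⟨j, -, hj⟩ : ∃ j ∈ Finset.univ, (∑ s ∈ S, M s j) / (S.card : ℝ) * x j ≠ 0 :=
    Finset.exists_ne_zero_of_sum_ne_zero (by rw [hSx]; exact one_ne_zero)
  have hxj : 0 < x j := (hx j).lt_of_ne' (right_ne_zero_of_mul hj)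
  have hlt := Finset.sum_lt_sum
    (fun k _ => mul_le_mul_of_nonneg_right (h k).le (hx k))
    ⟨j, Finset.mem_univ j, mul_lt_mul_of_pos_right (h j) hxj⟩
  rw [hSx, hTx] at hlt
  exact lt_irrefl 1 hlt
end

section
/- Let c ≥ 2 and m ≥ 1 be integers and let A be the adjacency matrix of G(c,m). Then for every natural number ℓ, the value (A^ℓ)_{vv} is the same for all independent-set vertices v, and the value (A^ℓ)_{uu} is the same for all clique vertices u (so G(c,m) has at most two walk-classes). Moreover, if m ≠ c then G(c,m) is not walk-regular. -/
open Matrix Kronecker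
open scoped Classical

/-- The graph `G(c,m)`: an independent set `Fin c` together with `m` cliques of size `c`
(indexed by `Fin m`), with a perfect matching from the independent set to each clique. -/
def gcm (c m : ℕ) : SimpleGraph (Fin c ⊕ Fin m × Fin c) :=
  SimpleGraph.fromRel fun a b =>
    match a, b with
    | Sum.inl i, Sum.inr (_, i') => i = i'
    | Sum.inr (j, i), Sum.inr (j', i') => j = j' ∧ i ≠ i'
    | _, _ => False
/-- Powers of the adjacency matrix are invariant under graph automorphisms. -/
theorem adjMat_pow_apply_iso {V : Type*} [Fintype V] [DecidableEq V] {G : SimpleGraph V}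
    (e : G ≃g G) (ℓ : ℕ) (v w : V) : (adjMat G ^ ℓ) (e v) (e w) = (adjMat G ^ ℓ) v w := by
  induction ℓ generalizing w with
  | zero => simp [Matrix.one_apply]
  | succ ℓ ih =>
    simp only [pow_succ, Matrix.mul_apply]
    rw [← e.toEquiv.sum_comp]
    refine Finset.sum_congr rfl fun u _ => ?_
    exact congrArg₂ (· * ·) (ih u) (by simp [adjMat, e.map_adj_iff])

/-- The diagonal entry at `v` of the squared adjacency matrix counts the neighbours of `v`. -/
theorem adjMat_sq_diag {V : Type*} [Fintype V] [DecidableEq V] (G : SimpleGraph V) (v : V) :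
    (adjMat G ^ 2) v v = ∑ w, if G.Adj v w then (1 : ℝ) else 0 := by
  rw [pow_two, Matrix.mul_apply]
  refine Finset.sum_congr rfl fun w _ => ?_
  by_cases hvw : G.Adj v w <;> simp [adjMat, G.adj_comm w v, hvw]

section gcm

variable {c m : ℕ}

theorem gcm_not_adj_inl_inl (i i' : Fin c) : ¬ (gcm c m).Adj (Sum.inl i) (Sum.inl i') := by
  simp [gcm]

theorem gcm_adj_inl_inr (i : Fin c) (u : Fin m × Fin c) :
    (gcm c m).Adj (Sum.inl i) (Sum.inr u) ↔ i = u.2 := by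
  simp [gcm]

theorem gcm_adj_inr_inl (u : Fin m × Fin c) (i : Fin c) :
    (gcm c m).Adj (Sum.inr u) (Sum.inl i) ↔ i = u.2 := by
  rw [SimpleGraph.adj_comm, gcm_adj_inl_inr]

theorem gcm_adj_inr_inr (u u' : Fin m × Fin c) :
    (gcm c m).Adj (Sum.inr u) (Sum.inr u') ↔ u.1 = u'.1 ∧ u.2 ≠ u'.2 := by
  simp only [gcm, SimpleGraph.fromRel_adj, ne_eq, Sum.inr.injEq, Prod.ext_iff]
  grind

/-- Permuting the cliques and, simultaneously in all parts, the matching index is an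
automorphism of `G(c,m)`. -/
def gcmIso (σ : Equiv.Perm (Fin m)) (τ : Equiv.Perm (Fin c)) : gcm c m ≃g gcm c m where
  toEquiv := Equiv.sumCongr τ (Equiv.prodCongr σ τ)
  map_rel_iff' := by
    rintro (i | u) (i' | u') <;>
      simp [gcm_not_adj_inl_inl, gcm_adj_inl_inr, gcm_adj_inr_inl, gcm_adj_inr_inr]

theorem adjMat_gcm_sq_inl (i : Fin c) :
    (adjMat (gcm c m) ^ 2) (Sum.inl i) (Sum.inl i) = m := by
  simp [adjMat_sq_diag, -Finset.sum_boole, gcm_not_adj_inl_inl, gcm_adj_inl_inr,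
    Fintype.sum_prod_type]

theorem adjMat_gcm_sq_inr (u : Fin m × Fin c) :
    (adjMat (gcm c m) ^ 2) (Sum.inr u) (Sum.inr u) = c := by
  have hne (i : Fin c) : (if u.2 = i then (0 : ℝ) else 1) = 1 - if u.2 = i then 1 else 0 := by
    split_ifs <;> simp
  simp [adjMat_sq_diag, -Finset.sum_boole, gcm_adj_inr_inl, gcm_adj_inr_inr,
    Fintype.sum_prod_type, ite_and, hne]

end gcm

/-- For `c ≥ 2`, `m ≥ 1`, in `G(c,m)` the diagonal entries of `A^ℓ` agree
on all independent-set vertices and agree on all clique vertices (so there are at most two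
walk-classes); moreover if `m ≠ c` then `G(c,m)` is not walk-regular. -/
theorem gcm_walk_classes (c m : ℕ) (hc : 2 ≤ c) (hm : 1 ≤ m) :
    (∀ ℓ : ℕ,
      (∀ v v' : Fin c,
        (adjMat (gcm c m) ^ ℓ) (Sum.inl v) (Sum.inl v)
          = (adjMat (gcm c m) ^ ℓ) (Sum.inl v') (Sum.inl v')) ∧
      (∀ u u' : Fin m × Fin c,
        (adjMat (gcm c m) ^ ℓ) (Sum.inr u) (Sum.inr u)
          = (adjMat (gcm c m) ^ ℓ) (Sum.inr u') (Sum.inr u'))) ∧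
    (m ≠ c → ¬ WalkRegular (gcm c m)) := by
  refine ⟨fun ℓ => ⟨fun v v' => ?_, fun u u' => ?_⟩, fun hmc h => hmc ?_⟩
  · simpa [gcmIso] using
      (adjMat_pow_apply_iso (gcmIso (m := m) 1 (Equiv.swap v v')) ℓ (Sum.inl v) (Sum.inl v)).symm
  · simpa [gcmIso, Prod.map] using (adjMat_pow_apply_iso
      (gcmIso (Equiv.swap u.1 u'.1) (Equiv.swap u.2 u'.2)) ℓ (Sum.inr u) (Sum.inr u)).symm
  · have hdiag := h 2 (Sum.inl ⟨0, by omega⟩) (Sum.inr (⟨0, hm⟩, ⟨0, by omega⟩))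
    rw [adjMat_gcm_sq_inl, adjMat_gcm_sq_inr] at hdiag
    exact_mod_cast hdiag
end

section
/- For all positive integers c and m, the characteristic polynomial of the real adjacency matrix A of the graph G(c,m) equals (X² − (c−1)·X − m) · (X − (c−1))^{m−1} · (X² + X − m)^{c−1} · (X + 1)^{(m−1)(c−1)}, a polynomial of degree c(m+1). -/
open Matrix Kronecker
open scoped Classical

open Polynomial

namespace Matrix

variable {R n ι : Type*} [CommRing R] [Fintype n] [DecidableEq n] [Fintype ι]

theorem det_scalar_sub_const [Nonempty n] (a b : R) :
    (scalar n a - of fun _ _ => b).det =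
      a ^ (Fintype.card n - 1) * (a - Fintype.card n * b) := by
  have h := congrArg (Polynomial.eval a)
    (charpoly_vecMulVec (fun _ : n => b) (fun _ : n => (1 : R)))
  rw [eval_charpoly] at h
  have hv : vecMulVec (fun _ : n => b) (fun _ : n => (1 : R)) = of fun _ _ => b := by
    ext i j
    simp [vecMulVec_apply]
  obtain ⟨k, hk⟩ := Nat.exists_eq_succ_of_ne_zero (Fintype.card_ne_zero (α := n))
  rw [hv] at h
  rw [h]
  simp [dotProduct, hk]
  ring

/-- The block row consisting of `ι`-many identity matrices. -/
def identityRow (R n ι : Type*) [CommRing R] [DecidableEq n] : Matrix n (ι × n) R :=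
  of fun i p => (1 : Matrix n n R) i p.2

theorem identityRow_mul_transpose :
    identityRow R n ι * (identityRow R n ι)ᵀ = scalar n (Fintype.card ι : R) := by
  ext i j
  by_cases h : i = j <;>
    simp [-map_natCast, identityRow, mul_apply, Fintype.sum_prod_type, one_apply, h]

variable [DecidableEq ι]

theorem one_kronecker_mul_identityRow_transpose (K : Matrix n n R) :
    ((1 : Matrix ι ι R) ⊗ₖ K) * (identityRow R n ι)ᵀ = (identityRow R n ι)ᵀ * K := by
  ext ⟨i, k⟩ j
  simp [identityRow, mul_apply, Fintype.sum_prod_type, one_apply]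

theorem det_fromBlocks_identityRow_mul_det (x : R) (K : Matrix n n R) :
    (fromBlocks (scalar n x) (-identityRow R n ι) (-(identityRow R n ι)ᵀ)
        ((1 : Matrix ι ι R) ⊗ₖ K)).det * K.det =
      (x • K - scalar n (Fintype.card ι : R)).det * K.det ^ Fintype.card ι := by
  have hK : K.det = (fromBlocks K 0 (identityRow R n ι)ᵀ 1).det := by simp
  conv_lhs => rw [hK]
  rw [← det_mul, fromBlocks_multiply, one_kronecker_mul_identityRow_transpose,
    Matrix.neg_mul, Matrix.neg_mul, identityRow_mul_transpose,
    Matrix.neg_mul, neg_add_cancel]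
  simp only [Matrix.mul_zero, Matrix.mul_one, zero_add, det_fromBlocks_zero₂₁, det_kronecker,
    det_one, one_pow, one_mul, ← sub_eq_add_neg]
  simp [-map_natCast, ← smul_eq_diagonal_mul]

end Matrix

theorem charmatrix_adjMat_gcm (c m : ℕ) :
    (adjMat (gcm c m)).charmatrix =
      fromBlocks (scalar (Fin c) (X : ℝ[X])) (-identityRow ℝ[X] (Fin c) (Fin m))
        (-(identityRow ℝ[X] (Fin c) (Fin m))ᵀ)
        ((1 : Matrix (Fin m) (Fin m) ℝ[X]) ⊗ₖ
          (scalar (Fin c) (X + 1 : ℝ[X]) - of fun _ _ => 1)) := by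
  ext1 a b
  rcases a with i | ⟨j, i⟩ <;> rcases b with i' | ⟨j', i'⟩
  · simp [charmatrix_apply, adjMat, gcm, diagonal_apply]
  · simp [adjMat, gcm, identityRow, one_apply, apply_ite C]
  · simp [adjMat, gcm, identityRow, one_apply, apply_ite C]
  · by_cases hj : j = j' <;> by_cases hi : i = i' <;>
      simp [adjMat, gcm, one_apply, hj, hi, eq_comm]

/-- For positive integers `c, m`, the characteristic polynomial of the
adjacency matrix of `G(c,m)` equals
`(X² − (c−1)X − m)·(X − (c−1))^(m−1)·(X² + X − m)^(c−1)·(X + 1)^((m−1)(c−1))`. -/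
theorem gcm_charpoly (c m : ℕ) (hc : 0 < c) (hm : 0 < m) :
    (adjMat (gcm c m)).charpoly =
      (X ^ 2 - Polynomial.C ((c : ℝ) - 1) * X - Polynomial.C (m : ℝ)) *
        (X - Polynomial.C ((c : ℝ) - 1)) ^ (m - 1) *
        (X ^ 2 + X - Polynomial.C (m : ℝ)) ^ (c - 1) *
        (X + 1) ^ ((m - 1) * (c - 1)) := by
  have : Nonempty (Fin c) := ⟨⟨0, hc⟩⟩
  set K : Matrix (Fin c) (Fin c) ℝ[X] := scalar (Fin c) (X + 1) - of fun _ _ => 1 with hK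
  have hdetK : K.det = (X + 1) ^ (c - 1) * (X - C ((c : ℝ) - 1)) := by
    rw [hK, det_scalar_sub_const]
    simp only [Fintype.card_fin, C_sub, C_1, map_natCast]
    ring
  have hS : ((X : ℝ[X]) • K - scalar (Fin c) (Fintype.card (Fin m) : ℝ[X])).det =
      (X ^ 2 + X - C (m : ℝ)) ^ (c - 1) * (X ^ 2 - C ((c : ℝ) - 1) * X - C (m : ℝ)) := by
    have h : (X : ℝ[X]) • K - scalar (Fin c) (Fintype.card (Fin m) : ℝ[X]) =
        scalar (Fin c) (X ^ 2 + X - C (m : ℝ)) - of fun _ _ => X := by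
      ext1 i j
      by_cases hij : i = j <;> simp [-map_natCast, hK, hij]
      simp only [map_natCast]
      ring
    rw [h, det_scalar_sub_const]
    simp only [Fintype.card_fin, C_sub, C_1, map_natCast]
    ring
  have hK0 : K.det ≠ 0 := by
    rw [hdetK]
    exact mul_ne_zero (pow_ne_zero _ (by simpa using X_add_C_ne_zero (1 : ℝ))) (X_sub_C_ne_zero _)
  have key := det_fromBlocks_identityRow_mul_det (ι := Fin m) (X : ℝ[X]) K
  rw [← charmatrix_adjMat_gcm, hS, Fintype.card_fin] at key
  obtain ⟨k, rfl⟩ := Nat.exists_eq_succ_of_ne_zero hm.ne'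
  rw [Nat.succ_eq_add_one, pow_succ K.det, ← mul_assoc] at key
  rw [charpoly, mul_right_cancel₀ hK0 key, hdetK, mul_pow, ← pow_mul]
  simp only [Nat.succ_eq_add_one, Nat.add_sub_cancel]
  ring
end
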